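/- Let p, q ∈ D be weakly comaximal with deg p even and deg q odd. Assume that either p has a unique real root, or q has a unique real root u such that p(u)·l.c.(p) > 0. Then the matrix [[p, q], [0, 0]] ∈ M₂(D) is a product of idempotent matrices over D. -/

import Mathlib

/-- The minimal Dress ring of `ℝ(X)`: the smallest subring of `RatFunc ℝ` containing
every element of the form `1/(1+x²)`. -/
noncomputable def DressD : Subring (RatFunc ℝ) :=
  Subring.closure {z : RatFunc ℝ | ∃ x : RatFunc ℝ, z = (1 + x ^ 2)⁻¹}

/-- Evaluation at a real number of an element of the Dress ring. -/
noncomputable def evalD (p : DressD) (u : ℝ) : ℝ :=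
  RatFunc.eval (RingHom.id ℝ) u (p : RatFunc ℝ)

/-- A `2 × 2` matrix is a product of idempotent matrices if it is the product of a
finite list of idempotent matrices. -/
def IsProductOfIdempotents {R : Type*} [CommRing R] (A : Matrix (Fin 2) (Fin 2) R) : Prop :=
  ∃ L : List (Matrix (Fin 2) (Fin 2) R), (∀ T ∈ L, IsIdempotentElem T) ∧ L.prod = A

section ProductsOfIdempotents

variable {R : Type*} [CommRing R]

namespace IsProductOfIdempotents

theorem of_isIdempotentElem {A : Matrix (Fin 2) (Fin 2) R} (hA : IsIdempotentElem A) :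
    IsProductOfIdempotents A :=
  ⟨[A], by simpa using hA, by simp⟩

theorem mul {A B : Matrix (Fin 2) (Fin 2) R} (hA : IsProductOfIdempotents A)
    (hB : IsProductOfIdempotents B) : IsProductOfIdempotents (A * B) := by
  obtain ⟨L, hL, rfl⟩ := hA
  obtain ⟨M, hM, rfl⟩ := hB
  refine ⟨L ++ M, fun T hT => ?_, List.prod_append⟩
  rcases List.mem_append.1 hT with h | h
  exacts [hL T h, hM T h]

theorem conj {A E F : Matrix (Fin 2) (Fin 2) R} (hEF : E * F = 1) (hFE : F * E = 1)
    (hA : IsProductOfIdempotents A) : IsProductOfIdempotents (F * A * E) := by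
  obtain ⟨L, hL, rfl⟩ := hA
  refine ⟨L.map fun T => F * T * E, fun T hT => ?_, ?_⟩
  · obtain ⟨S, hS, rfl⟩ := List.mem_map.1 hT
    calc F * S * E * (F * S * E) = F * S * (E * F) * S * E := by noncomm_ring
      _ = F * (S * S) * E := by rw [hEF]; noncomm_ring
      _ = F * S * E := by rw [hL S hS]
  · clear hL
    induction L with
    | nil => simpa using hFE.symm
    | cons S L ih =>
      rw [List.map_cons, List.prod_cons, ih, List.prod_cons]
      calc F * S * E * (F * L.prod * E) = F * S * (E * F) * L.prod * E := by noncomm_ring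
        _ = F * (S * L.prod) * E := by rw [hEF]; noncomm_ring

theorem row_one (x : R) : IsProductOfIdempotents !![1, x; 0, 0] :=
  of_isIdempotentElem (by ext i j; fin_cases i <;> fin_cases j <;> simp)

theorem row_smul {a b : R} (d : R) (h : IsProductOfIdempotents !![a, b; 0, 0]) :
    IsProductOfIdempotents !![d * a, d * b; 0, 0] := by
  have h₁ : IsProductOfIdempotents (!![0, 0; 1, 1] : Matrix (Fin 2) (Fin 2) R) :=
    of_isIdempotentElem (by ext i j; fin_cases i <;> fin_cases j <;> simp)
  convert! (((row_one d).mul h₁).mul (row_one 0)).mul h using 1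
  simp

theorem row_add_mul {a b : R} (y : R) (h : IsProductOfIdempotents !![a, b; 0, 0]) :
    IsProductOfIdempotents !![a + y * b, b; 0, 0] := by
  have hc := h.conj (E := !![1, 0; y, 1]) (F := !![1, 0; -y, 1])
    (by simp [Matrix.one_fin_two]) (by simp [Matrix.one_fin_two])
  convert! (row_one 0).mul hc using 1
  simp [mul_comm]

theorem row_of_idempotent {a b c d : R} (h : IsIdempotentElem !![a, b; c, d]) :
    IsProductOfIdempotents !![a, b; 0, 0] := by
  convert! (row_one 0).mul (of_isIdempotentElem h) using 1
  simp

theorem row_add_mul_right {a b : R} (y : R) (h : IsProductOfIdempotents !![a, b; 0, 0]) :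
    IsProductOfIdempotents !![a, b + y * a; 0, 0] := by
  have hc := h.conj (E := !![1, y; 0, 1]) (F := !![1, -y; 0, 1])
    (by simp [Matrix.one_fin_two]) (by simp [Matrix.one_fin_two])
  convert! (row_one y).mul hc using 1
  simp [mul_comm, add_comm]

end IsProductOfIdempotents

end ProductsOfIdempotents

open Polynomial

namespace Polynomial

theorem natDegree_sq_le_natDegree_sq_add_sq {f g : ℝ[X]} (hg : g ≠ 0) :
    (g ^ 2).natDegree ≤ (f ^ 2 + g ^ 2).natDegree := by
  rcases lt_or_ge g.natDegree f.natDegree with h | h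
  · rw [natDegree_add_eq_left_of_natDegree_lt] <;> simp only [natDegree_pow] <;> omega
  · rw [natDegree_pow]
    apply le_natDegree_of_ne_zero
    rw [coeff_add, coeff_pow_of_natDegree_le h, coeff_pow_of_natDegree_le le_rfl]
    have : 0 < g.coeff g.natDegree ^ 2 := by
      have : g.coeff g.natDegree ≠ 0 := by simpa using hg
      positivity
    positivity

theorem eval_pos_of_monic_of_no_roots {f : ℝ[X]} (hf : f.Monic) (h : ∀ x, f.eval x ≠ 0) (x : ℝ) :
    0 < f.eval x :=
  zero_lt_eval_of_roots_lt_of_leadingCoeff_nonneg (fun y hy => absurd hy (h y))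
    (by simp [hf.leadingCoeff])

theorem even_natDegree_of_no_roots {f : ℝ[X]} (hf : f.Monic) (h : ∀ x, f.eval x ≠ 0) :
    Even f.natDegree := by
  by_contra hodd
  have h₁ := eval_pos_of_monic_of_no_roots hf h 0
  have h₂ := zero_lt_negOnePow_mul_eval_of_lt_roots_of_leadingCoeff_nonneg
    (fun y hy => absurd hy (h y)) (x := 0) (P := f) (by simp [hf.leadingCoeff])
  rw [Int.negOnePow_odd _ (by simpa using hodd)] at h₂
  simp at h₂
  linarith

/-- A real polynomial of even degree and positive leading coefficient with a single real root
is positive away from it. -/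
theorem eval_pos_of_unique_root {f : ℝ[X]} {u : ℝ} (hlc : 0 < f.leadingCoeff)
    (heven : Even f.natDegree) (hu : ∀ v, f.eval v = 0 → v = u) {v : ℝ} (hv : v ≠ u) :
    0 < f.eval v := by
  rcases lt_or_gt_of_ne hv with h | h
  · have h₂ := zero_lt_negOnePow_mul_eval_of_lt_roots_of_leadingCoeff_nonneg
      (fun y hy => (hu y hy) ▸ h) (x := v) (P := f) hlc.le
    rw [Int.negOnePow_even _ (by simpa using heven)] at h₂
    simpa using h₂
  · exact zero_lt_eval_of_roots_lt_of_leadingCoeff_nonneg (fun y hy => (hu y hy) ▸ h) hlc.le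

theorem isCompact_setOf_eval_nonpos {f : ℝ[X]} (hlc : 0 < f.leadingCoeff)
    (heven : Even f.natDegree) : IsCompact {x | f.eval x ≤ 0} := by
  have hfin : {x | f.IsRoot x}.Finite := finite_setOfPred_isRoot (by rintro rfl; simp at hlc)
  obtain ⟨a, ha⟩ := hfin.bddBelow
  obtain ⟨b, hb⟩ := hfin.bddAbove
  refine (isCompact_Icc (a := a) (b := b)).of_isClosed_subset
    (isClosed_le f.continuous continuous_const) fun x hx => ⟨?_, ?_⟩
  · by_contra! hlt
    have h₂ := zero_lt_negOnePow_mul_eval_of_lt_roots_of_leadingCoeff_nonneg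
      (fun y hy => hlt.trans_le (ha hy)) (x := x) (P := f) hlc.le
    rw [Int.negOnePow_even _ (by simpa using heven)] at h₂
    simp only [Units.val_one, Int.cast_one, one_mul] at h₂
    exact absurd h₂ (not_lt.2 hx)
  · by_contra! hlt
    exact absurd (zero_lt_eval_of_roots_lt_of_leadingCoeff_nonneg
      (fun y hy => (hb hy).trans_lt hlt) hlc.le) (not_lt.2 hx)

theorem exists_forall_eval_mul_add_mul_sq_pos {f g h : ℝ[X]} (hlc : 0 < f.leadingCoeff)
    (heven : Even f.natDegree) (hfg : ∀ x, g.eval x = 0 → 0 < f.eval x)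
    (hh : ∀ x, 0 < h.eval x) :
    ∃ c : ℝ, 0 < c ∧ ∀ x, 0 < (f * h + C c * g ^ 2).eval x := by
  have hg : ∀ x, f.eval x ≤ 0 → 0 < g.eval x ^ 2 := fun x hx => by
    have : g.eval x ≠ 0 := fun h0 => absurd (hfg x h0) (not_lt.2 hx)
    positivity
  have hcont : ContinuousOn (fun x => -(f.eval x * h.eval x) / g.eval x ^ 2)
      {x | f.eval x ≤ 0} := by
    refine ContinuousOn.div ?_ ?_ fun x hx => (hg x hx).ne' <;> fun_prop
  obtain ⟨M, hM⟩ := (isCompact_setOf_eval_nonpos hlc heven).bddAbove_image hcont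
  refine ⟨max M 0 + 1, by positivity, fun x => ?_⟩
  simp only [eval_add, eval_mul, eval_C, eval_pow]
  rcases le_or_gt (f.eval x) 0 with hx | hx
  · have h₁ := hM ⟨x, hx, rfl⟩
    simp only at h₁
    rw [div_le_iff₀ (hg x hx)] at h₁
    nlinarith [hg x hx, mul_le_mul_of_nonneg_right (le_max_left M 0) (hg x hx).le]
  · have := hh x
    positivity

end Polynomial

namespace DressD

theorem inv_one_add_sq_mem (x : RatFunc ℝ) : (1 + x ^ 2)⁻¹ ∈ DressD :=
  Subring.subset_closure ⟨x, rfl⟩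

theorem denom_no_roots_and_intDegree_nonpos {z : RatFunc ℝ} (hz : z ∈ DressD) :
    (∀ u, z.denom.eval u ≠ 0) ∧ z.intDegree ≤ 0 := by
  have of_dvd : ∀ {f g : ℝ[X]}, f ∣ g → (∀ u, g.eval u ≠ 0) → ∀ u, f.eval u ≠ 0 :=
    fun h hg u h0 => hg u (eval_eq_zero_of_dvd_of_eval_eq_zero h h0)
  induction hz using Subring.closure_induction with
  | mem z hz =>
    obtain ⟨x, rfl⟩ := hz
    have hb := RatFunc.denom_ne_zero x
    have hno : ∀ u, (x.num ^ 2 + x.denom ^ 2).eval u ≠ 0 := by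
      intro u hu
      simp only [eval_add, eval_pow] at hu
      have h₁ : x.num.eval u = 0 := by nlinarith [sq_nonneg (x.denom.eval u)]
      have h₂ : x.denom.eval u = 0 := by nlinarith [sq_nonneg (x.num.eval u)]
      obtain ⟨a, b, hab⟩ := RatFunc.isCoprime_num_denom x
      have := congrArg (eval u) hab
      simp [h₁, h₂] at this
    have hne : x.num ^ 2 + x.denom ^ 2 ≠ 0 := fun h => hno 0 (by rw [h, eval_zero])
    have hx : (1 + x ^ 2)⁻¹ = algebraMap ℝ[X] (RatFunc ℝ) (x.denom ^ 2) /
        algebraMap ℝ[X] (RatFunc ℝ) (x.num ^ 2 + x.denom ^ 2) := by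
      have hb' := RatFunc.algebraMap_ne_zero hb
      conv_lhs => rw [← RatFunc.num_div_denom x]
      rw [← inv_inj, inv_inv, inv_div]
      simp only [map_add, map_pow]
      field_simp
      ring
    refine ⟨of_dvd (by rw [hx]; exact RatFunc.denom_div_dvd _ _) hno, ?_⟩
    rw [hx, RatFunc.intDegree_div (RatFunc.algebraMap_ne_zero (pow_ne_zero 2 hb))
      (RatFunc.algebraMap_ne_zero hne), RatFunc.intDegree_polynomial, RatFunc.intDegree_polynomial]
    have := natDegree_sq_le_natDegree_sq_add_sq (f := x.num) hb
    omega
  | zero => simp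
  | one => simp
  | add x y _ _ hx hy =>
    refine ⟨of_dvd (RatFunc.denom_add_dvd x y) fun u => ?_, ?_⟩
    · simpa using ⟨hx.1 u, hy.1 u⟩
    · by_cases hy0 : y = 0
      · simpa [hy0] using hx.2
      by_cases hxy : x + y = 0
      · simp [hxy]
      exact (RatFunc.intDegree_add_le hy0 hxy).trans (max_le hx.2 hy.2)
  | neg x _ hx =>
    refine ⟨of_dvd ?_ hx.1, by simpa using hx.2⟩
    rw [RatFunc.denom_dvd (RatFunc.denom_ne_zero x)]
    exact ⟨-x.num, by rw [map_neg, neg_div, RatFunc.num_div_denom]⟩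
  | mul x y _ _ hx hy =>
    refine ⟨of_dvd (RatFunc.denom_mul_dvd x y) fun u => ?_, ?_⟩
    · simpa using ⟨hx.1 u, hy.1 u⟩
    · by_cases hx0 : x = 0
      · simp [hx0]
      by_cases hy0 : y = 0
      · simp [hy0]
      rw [RatFunc.intDegree_mul hx0 hy0]
      exact add_nonpos hx.2 hy.2

theorem algebraMap_C_mem (c : ℝ) : algebraMap ℝ[X] (RatFunc ℝ) (C c) ∈ DressD := by
  obtain ⟨n, hn⟩ := exists_nat_gt |c|
  obtain ⟨h₁, h₂⟩ := abs_lt.1 hn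
  have hn0 : (0 : ℝ) < n := (abs_nonneg c).trans_lt hn
  set t : ℝ := (c + n) / (2 * n) with ht
  have ht0 : 0 < t := div_pos (by linarith) (by linarith)
  have ht1 : t ≤ 1 := by rw [ht, div_le_one (by linarith)]; linarith
  have hmem : RatFunc.C t ∈ DressD := by
    convert! inv_one_add_sq_mem (RatFunc.C √(t⁻¹ - 1)) using 1
    rw [← map_pow, Real.sq_sqrt (by rw [sub_nonneg]; exact (one_le_inv₀ ht0).2 ht1), map_sub,
      map_one, add_sub_cancel, map_inv₀, inv_inv]
  have hc : c = n * (2 * t - 1) := by rw [ht]; field_simp; ring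
  rw [RatFunc.algebraMap_C, hc, map_mul, map_natCast, map_sub, map_mul, map_ofNat, map_one]
  exact mul_mem (natCast_mem _ n) (sub_mem (mul_mem (ofNat_mem _ 2) hmem) (one_mem _))

theorem linear_div_quadratic_mem {a b : ℝ} (hb : b ≠ 0) (c d : ℝ) :
    algebraMap ℝ[X] (RatFunc ℝ) (C c * X + C d) /
      algebraMap ℝ[X] (RatFunc ℝ) ((X - C a) ^ 2 + C b ^ 2) ∈ DressD := by
  have hB : RatFunc.C b ≠ 0 := by simpa using hb
  have hQ : (RatFunc.X - RatFunc.C a) ^ 2 + RatFunc.C b ^ 2 ≠ 0 := by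
    have : (X - C a) ^ 2 + C b ^ 2 ≠ (0 : ℝ[X]) := fun h => by
      have := congrArg (eval a) h
      simp [hb] at this
    simpa using RatFunc.algebraMap_ne_zero this
  have hY : RatFunc.X - RatFunc.C a - RatFunc.C b ≠ 0 := by
    have : X - C a - C b ≠ (0 : ℝ[X]) := fun h => by
      have := congrArg (eval (a + b + 1)) h
      simp only [eval_sub, eval_X, eval_C, eval_zero] at this
      linarith
    simpa using RatFunc.algebraMap_ne_zero this
  have h₁ := inv_one_add_sq_mem ((RatFunc.X - RatFunc.C a) / RatFunc.C b)
  have h₂ := inv_one_add_sq_mem ((RatFunc.X - RatFunc.C a + RatFunc.C b) /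
    (RatFunc.X - RatFunc.C a - RatFunc.C b))
  have h₃ := algebraMap_C_mem (1 / 2)
  have h₄ := algebraMap_C_mem (c / b)
  have h₅ := algebraMap_C_mem ((d + c * a) / b ^ 2)
  convert! add_mem (mul_mem h₄ (sub_mem h₃ h₂)) (mul_mem h₅ h₁) using 1
  simp only [map_add, map_sub, map_mul, map_pow, map_div₀, RatFunc.algebraMap_C,
    RatFunc.algebraMap_X, map_one, map_ofNat]
  generalize RatFunc.C a = a' at *
  generalize RatFunc.C b = b' at *
  generalize RatFunc.C c = c'
  generalize RatFunc.C d = d'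
  generalize (RatFunc.X : RatFunc ℝ) = x at *
  have e₁ : (1 + ((x - a') / b') ^ 2)⁻¹ = b' ^ 2 / ((x - a') ^ 2 + b' ^ 2) := by
    rw [← inv_inj, inv_inv, inv_div]
    field_simp
    ring
  have e₂ : (1 + ((x - a' + b') / (x - a' - b')) ^ 2)⁻¹ =
      (x - a' - b') ^ 2 / (2 * ((x - a') ^ 2 + b' ^ 2)) := by
    rw [← inv_inj, inv_inv, inv_div]
    field_simp
    ring
  rw [e₁, e₂]
  field_simp
  ring

/-- Fractions of real polynomials without real poles, including at infinity, lie in the minimal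
Dress ring. -/
theorem div_mem (f g : ℝ[X]) (hg : ∀ u, g.eval u ≠ 0) (hfg : f.natDegree ≤ g.natDegree) :
    algebraMap ℝ[X] (RatFunc ℝ) f / algebraMap ℝ[X] (RatFunc ℝ) g ∈ DressD := by
  induction hn : g.natDegree using Nat.strong_induction_on generalizing f g with
  | _ n ih =>
  subst hn
  rcases Nat.eq_zero_or_pos g.natDegree with h0 | hpos
  · rw [eq_C_of_natDegree_eq_zero h0, eq_C_of_natDegree_le_zero (p := f) (h0 ▸ hfg),
      RatFunc.algebraMap_C, RatFunc.algebraMap_C, ← map_div₀, ← RatFunc.algebraMap_C]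
    exact algebraMap_C_mem _
  obtain ⟨z, hz⟩ : ∃ z : ℂ, aeval z g = 0 :=
    IsAlgClosed.exists_aeval_eq_zero _ g (natDegree_pos_iff_degree_pos.1 hpos).ne'
  have him : z.im ≠ 0 := by
    intro h
    have hzr : z = (z.re : ℂ) := by apply Complex.ext <;> simp [h]
    rw [hzr, ← Complex.coe_algebraMap, aeval_algebraMap_apply] at hz
    exact hg z.re (by simpa using hz)
  obtain ⟨k, hk⟩ := g.quadratic_dvd_of_aeval_eq_zero_im_ne_zero hz him
  have hQ : (X ^ 2 - C (2 * z.re) * X + C (‖z‖ ^ 2) : ℝ[X]) =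
      (X - C z.re) ^ 2 + C z.im ^ 2 := by
    rw [Complex.sq_norm, Complex.normSq_apply]
    simp only [map_mul, map_add, map_ofNat]
    ring
  rw [hQ] at hk
  set Q : ℝ[X] := (X - C z.re) ^ 2 + C z.im ^ 2 with hQdef
  have hQform : Q = C 1 * X ^ 2 + C (-(2 * z.re)) * X + C (‖z‖ ^ 2) := by
    rw [← hQ]; simp [sub_eq_add_neg]
  have hQm : Q.Monic := by
    rw [Monic, hQform, leadingCoeff_quadratic one_ne_zero]
  have hQd : Q.natDegree = 2 := by
    rw [hQform, natDegree_quadratic one_ne_zero]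
  have hk0 : k ≠ 0 := by rintro rfl; simp [hk] at hpos
  have hkno : ∀ u, k.eval u ≠ 0 := fun u h => hg u (by rw [hk, eval_mul, h, mul_zero])
  have hgd : g.natDegree = 2 + k.natDegree := by rw [hk, hQm.natDegree_mul' hk0, hQd]
  have hdiv : (f /ₘ Q).natDegree ≤ k.natDegree := by
    rw [natDegree_divByMonic f hQm, hQd]; omega
  have hmod : (f %ₘ Q).natDegree ≤ 1 := by
    have := natDegree_modByMonic_lt f hQm (by rintro h; rw [h] at hQd; simp at hQd)
    omega
  have h₁ := ih k.natDegree (by omega) (f /ₘ Q) k hkno hdiv rfl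
  have h₂ := ih k.natDegree (by omega) 1 k hkno (by simp) rfl
  have h₃ : algebraMap ℝ[X] (RatFunc ℝ) (f %ₘ Q) / algebraMap ℝ[X] (RatFunc ℝ) Q ∈ DressD := by
    rw [eq_X_add_C_of_natDegree_le_one hmod]
    exact linear_div_quadratic_mem him _ _
  convert! add_mem h₁ (mul_mem h₃ h₂) using 1
  conv_lhs => rw [← modByMonic_add_div f Q, hk]
  have hk' := RatFunc.algebraMap_ne_zero hk0
  have hQ' := RatFunc.algebraMap_ne_zero hQm.ne_zero
  simp only [map_add, map_mul, map_one]
  field_simp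
  ring

end DressD

namespace DressD

theorem eq_num_div_denom (p : DressD) : (p : RatFunc ℝ) =
    algebraMap ℝ[X] (RatFunc ℝ) (p : RatFunc ℝ).num /
      algebraMap ℝ[X] (RatFunc ℝ) (p : RatFunc ℝ).denom :=
  (RatFunc.num_div_denom _).symm

theorem evalD_eq (p : DressD) (u : ℝ) :
    evalD p u = (p : RatFunc ℝ).num.eval u / (p : RatFunc ℝ).denom.eval u := rfl

theorem denom_eval_ne_zero (p : DressD) (u : ℝ) : (p : RatFunc ℝ).denom.eval u ≠ 0 :=
  (denom_no_roots_and_intDegree_nonpos p.2).1 u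

theorem natDegree_num_le (p : DressD) :
    (p : RatFunc ℝ).num.natDegree ≤ (p : RatFunc ℝ).denom.natDegree := by
  have := (denom_no_roots_and_intDegree_nonpos p.2).2
  rw [RatFunc.intDegree] at this
  omega

theorem evalD_eq_zero_iff (p : DressD) (u : ℝ) :
    evalD p u = 0 ↔ (p : RatFunc ℝ).num.eval u = 0 := by
  rw [evalD_eq, div_eq_zero_iff, or_iff_left (denom_eval_ne_zero p u)]

theorem even_natDegree_num_iff (p : DressD) :
    Even (p : RatFunc ℝ).num.natDegree ↔ Even (p : RatFunc ℝ).intDegree := by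
  have := even_natDegree_of_no_roots (RatFunc.monic_denom (p : RatFunc ℝ)) (denom_eval_ne_zero p)
  rw [RatFunc.intDegree, Int.even_sub, Int.even_coe_nat, Int.even_coe_nat]
  tauto

theorem ne_zero_of_eval_pos {f : ℝ[X]} (hf : ∀ u, 0 < f.eval u) : f ≠ 0 := by
  rintro rfl
  simpa using hf 0

theorem isProductOfIdempotents_row_of_add_mul_sq {F G Γ h : ℝ[X]} {c : ℝ}
    (hΓ : ∀ u, 0 < Γ.eval u) (hh : ∀ u, 0 < h.eval u) (hhΓ : h.natDegree ≤ Γ.natDegree)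
    (hGh : G.natDegree ≤ h.natDegree) {e x₁ x₂ P Q : DressD}
    (hx : IsProductOfIdempotents !![x₁, x₂; 0, 0])
    (h₁ : (e * x₁ : RatFunc ℝ) = algebraMap ℝ[X] (RatFunc ℝ) (F * h + C c * G ^ 2) /
      algebraMap ℝ[X] (RatFunc ℝ) (h ^ 2))
    (h₂ : (e * x₂ : RatFunc ℝ) = algebraMap ℝ[X] (RatFunc ℝ) G / algebraMap ℝ[X] (RatFunc ℝ) h)
    (hP : (P : RatFunc ℝ) = algebraMap ℝ[X] (RatFunc ℝ) F / algebraMap ℝ[X] (RatFunc ℝ) Γ)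
    (hQ : (Q : RatFunc ℝ) = algebraMap ℝ[X] (RatFunc ℝ) G / algebraMap ℝ[X] (RatFunc ℝ) Γ) :
    IsProductOfIdempotents !![P, Q; 0, 0] := by
  have hΓ0 := RatFunc.algebraMap_ne_zero (ne_zero_of_eval_pos hΓ)
  have hh0 := RatFunc.algebraMap_ne_zero (ne_zero_of_eval_pos hh)
  let d : DressD := ⟨_, div_mem h Γ (fun u => (hΓ u).ne') hhΓ⟩
  let y : DressD := ⟨_, div_mem (C c * G) h (fun u => (hh u).ne')
    ((natDegree_C_mul_le c G).trans hGh)⟩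
  have hQ' : Q = d * (e * x₂) := by
    apply Subtype.ext
    rw [hQ, Subring.coe_mul, Subring.coe_mul, h₂]
    simp only [d]
    field_simp
  have hP' : P = d * (e * x₁ + -y * (e * x₂)) := by
    apply Subtype.ext
    rw [hP, Subring.coe_mul, Subring.coe_add, Subring.coe_mul, Subring.coe_mul, Subring.coe_mul,
      Subring.coe_neg, h₁, h₂]
    simp only [d, y, map_add, map_mul, map_pow]
    field_simp
    ring
  rw [hP', hQ']
  exact ((hx.row_smul e).row_add_mul (-y)).row_smul d

theorem isProductOfIdempotents_row_of_natDegree_lt {F G Γ : ℝ[X]}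
    (hΓ : ∀ u, 0 < Γ.eval u) (hFΓ : F.natDegree ≤ Γ.natDegree) (hF : Even F.natDegree)
    (hGF : G.natDegree < F.natDegree)
    (hlc : 0 < F.leadingCoeff) (hFG : ∀ u, G.eval u = 0 → 0 < F.eval u) {P Q : DressD}
    (hP : (P : RatFunc ℝ) = algebraMap ℝ[X] (RatFunc ℝ) F / algebraMap ℝ[X] (RatFunc ℝ) Γ)
    (hQ : (Q : RatFunc ℝ) = algebraMap ℝ[X] (RatFunc ℝ) G / algebraMap ℝ[X] (RatFunc ℝ) Γ) :
    IsProductOfIdempotents !![P, Q; 0, 0] := by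
  obtain ⟨k, hk⟩ := hF
  set h : ℝ[X] := (1 + X ^ 2) ^ k with hhdef
  have hh : ∀ u, 0 < h.eval u := fun u => by
    simp only [hhdef, eval_pow, eval_add, eval_one, eval_X]
    positivity
  have hhd : h.natDegree = F.natDegree := by
    have : (1 + X ^ 2 : ℝ[X]).natDegree = 2 := by compute_degree!
    rw [natDegree_pow, this, hk]
    ring
  obtain ⟨c, -, hW⟩ := exists_forall_eval_mul_add_mul_sq_pos hlc ⟨k, hk⟩ hFG hh
  have hF0 : F ≠ 0 := by rintro rfl; simp at hlc
  have hh0 := ne_zero_of_eval_pos hh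
  have hWd : (F * h + C c * G ^ 2).natDegree = 2 * F.natDegree := by
    rw [natDegree_add_eq_left_of_natDegree_lt]
    · rw [natDegree_mul hF0 hh0, hhd]; ring
    · rw [natDegree_mul hF0 hh0, hhd]
      refine (natDegree_C_mul_le _ _).trans_lt ?_
      rw [natDegree_pow]
      omega
  set W := F * h + C c * G ^ 2
  have hh0' := RatFunc.algebraMap_ne_zero hh0
  have hW0' := RatFunc.algebraMap_ne_zero (ne_zero_of_eval_pos hW)
  let e : DressD := ⟨_, div_mem W (h ^ 2) (fun u => by simpa using (hh u).ne')
    (by rw [hWd, natDegree_pow, hhd])⟩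
  let x : DressD := ⟨_, div_mem (G * h) W (fun u => (hW u).ne')
    (by refine natDegree_mul_le.trans ?_; omega)⟩
  refine isProductOfIdempotents_row_of_add_mul_sq (c := c) (e := e) (x₁ := 1) (x₂ := x)
    hΓ hh (hhd ▸ hFΓ) (hhd ▸ hGF.le) (.row_one x) (by simp [e, W]) ?_ hP hQ
  simp only [e, x, map_mul, map_pow]
  field_simp

theorem isProductOfIdempotents_row_of_lt_natDegree {F G Γ : ℝ[X]}
    (hΓ : ∀ u, 0 < Γ.eval u) (hGΓ : G.natDegree < Γ.natDegree)
    (hF : Even F.natDegree) (hG : Odd G.natDegree) (hGF : F.natDegree < G.natDegree)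
    (hlc : 0 < F.leadingCoeff) (hFG : ∀ u, G.eval u = 0 → 0 < F.eval u) {P Q : DressD}
    (hP : (P : RatFunc ℝ) = algebraMap ℝ[X] (RatFunc ℝ) F / algebraMap ℝ[X] (RatFunc ℝ) Γ)
    (hQ : (Q : RatFunc ℝ) = algebraMap ℝ[X] (RatFunc ℝ) G / algebraMap ℝ[X] (RatFunc ℝ) Γ) :
    IsProductOfIdempotents !![P, Q; 0, 0] := by
  obtain ⟨n, hn⟩ := hG
  set s : ℝ[X] := 1 + X ^ 2 with hsdef
  have hsd : s.natDegree = 2 := by rw [hsdef]; compute_degree!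
  have hs : ∀ u, 0 < s.eval u := fun u => by
    simp only [hsdef, eval_pow, eval_add, eval_one, eval_X]
    positivity
  set h : ℝ[X] := s ^ (n + 1) with hhdef
  have hh : ∀ u, 0 < h.eval u := fun u => by
    rw [hhdef, eval_pow]
    exact pow_pos (hs u) _
  have hhd : h.natDegree = G.natDegree + 1 := by rw [natDegree_pow, hsd, hn]; ring
  have hhlc : h.leadingCoeff = 1 := by
    have hsm : s.Monic := by rw [Monic, leadingCoeff, hsd, hsdef]; simp [coeff_one]
    exact hsm.pow (n + 1)
  obtain ⟨c, hc, hW⟩ := exists_forall_eval_mul_add_mul_sq_pos hlc hF hFG hh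
  have hF0 : F ≠ 0 := by rintro rfl; simp at hlc
  have hG0 : G ≠ 0 := by rintro rfl; simp at hn
  have hh0 := ne_zero_of_eval_pos hh
  have hs0 := ne_zero_of_eval_pos hs
  have hFh : (F * h).natDegree ≤ 2 * G.natDegree := by
    obtain ⟨m, hm⟩ := hF
    rw [natDegree_mul hF0 hh0, hhd]
    omega
  have hWd : (F * h + C c * G ^ 2).natDegree = 2 * G.natDegree := by
    apply le_antisymm
    · refine natDegree_add_le_of_degree_le hFh ((natDegree_C_mul_le _ _).trans ?_)
      rw [natDegree_pow]
    · apply le_natDegree_of_ne_zero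
      rw [coeff_add, coeff_C_mul, coeff_pow_of_natDegree_le le_rfl, coeff_natDegree]
      have h₁ : 0 ≤ (F * h).coeff (2 * G.natDegree) := by
        rcases hFh.eq_or_lt with heq | hlt
        · rw [← heq, coeff_natDegree, leadingCoeff_mul, hhlc, mul_one]
          exact hlc.le
        · rw [coeff_eq_zero_of_natDegree_lt hlt]
      have h₂ : G.leadingCoeff ≠ 0 := leadingCoeff_ne_zero.2 hG0
      positivity
  set W := F * h + C c * G ^ 2
  have hW0 := ne_zero_of_eval_pos hW
  set a : ℝ := G.leadingCoeff / W.leadingCoeff with ha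
  have ha0 : a ≠ 0 := div_ne_zero (leadingCoeff_ne_zero.2 hG0) (leadingCoeff_ne_zero.2 hW0)
  have hXW : (C a * (X * W)).natDegree = 2 * G.natDegree + 1 := by
    rw [natDegree_C_mul ha0, natDegree_X_mul hW0, hWd]
  have hGh : (G * h).natDegree = 2 * G.natDegree + 1 := by
    rw [natDegree_mul hG0 hh0, hhd]; ring
  have hr : (G * h - C a * (X * W)).natDegree ≤ W.natDegree := by
    by_cases h0 : G * h - C a * (X * W) = 0
    · simp [h0]
    have hlt : (G * h - C a * (X * W)).degree < (G * h).degree := by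
      apply degree_sub_lt_left
      · rw [degree_eq_natDegree (mul_ne_zero hG0 hh0), hGh, degree_eq_natDegree
          (by simp [ha0, hW0]), hXW]
      · exact mul_ne_zero hG0 hh0
      · have := leadingCoeff_ne_zero.2 hW0
        simp only [leadingCoeff_mul, leadingCoeff_C, leadingCoeff_X, hhlc, ha]
        field_simp
    have := natDegree_lt_natDegree h0 hlt
    omega
  have hh0' := RatFunc.algebraMap_ne_zero hh0
  have hW0' := RatFunc.algebraMap_ne_zero hW0
  have hs0' := RatFunc.algebraMap_ne_zero hs0
  have ha0' : RatFunc.C a ≠ 0 := by simpa using ha0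
  have hsne : ∀ u, s.eval u ≠ 0 := fun u => (hs u).ne'
  let e : DressD := ⟨_, div_mem (W * s) (h ^ 2) (fun u => by simpa using (hh u).ne')
    (by rw [natDegree_mul hW0 hs0, hWd, natDegree_pow, hhd, hsd]; omega)⟩
  let r : DressD := ⟨_, div_mem (G * h - C a * (X * W)) W (fun u => (hW u).ne') hr⟩
  let x₁ : DressD := ⟨_, div_mem 1 s hsne (by simp)⟩
  let x₂ : DressD := ⟨_, div_mem (C a * X) s hsne
    (by refine (natDegree_C_mul_le _ _).trans ?_; simp [hsd])⟩
  let x₃ : DressD := ⟨_, div_mem (C a⁻¹ * X) s hsne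
    (by refine (natDegree_C_mul_le _ _).trans ?_; simp [hsd])⟩
  let x₄ : DressD := ⟨_, div_mem (X ^ 2) s hsne (by simp [hsd])⟩
  have hsX : algebraMap ℝ[X] (RatFunc ℝ) s = 1 + RatFunc.X ^ 2 := by simp [hsdef]
  have hidem : IsIdempotentElem !![x₁, x₂; x₃, x₄] := by
    rw [hsX] at hs0'
    rw [IsIdempotentElem, Matrix.mul_fin_two]
    congr! 4 <;> (first | apply Subtype.ext | (congr 1; apply Subtype.ext)) <;>
      simp only [x₁, x₂, x₃, x₄, Subring.coe_add, Subring.coe_mul, map_mul, map_pow, map_one, hsX,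
        RatFunc.algebraMap_C, RatFunc.algebraMap_X, map_inv₀] <;> field_simp
  refine isProductOfIdempotents_row_of_add_mul_sq (c := c) (e := e) (x₁ := x₁) (x₂ := x₂ + r * x₁)
    hΓ hh (hhd ▸ hGΓ) (by omega)
    ((IsProductOfIdempotents.row_of_idempotent hidem).row_add_mul_right r) ?_ ?_ hP hQ
  · simp only [e, x₁, map_mul, map_one, W]
    field_simp
  · simp only [e, r, x₁, x₂, Subring.coe_add, Subring.coe_mul, map_mul, map_sub, map_pow, map_one]
    field_simp
    ring

end DressD

theorem stmt_12 (p q : DressD)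
    (hcomax : ¬∃ u : ℝ, evalD p u = 0 ∧ evalD q u = 0)
    (hpeven : Even (RatFunc.intDegree (p : RatFunc ℝ)))
    (hqodd : Odd (RatFunc.intDegree (q : RatFunc ℝ)))
    (hroot : (∃! u : ℝ, evalD p u = 0) ∨
      (∃ u : ℝ, {v : ℝ | evalD q v = 0} = {u} ∧
        0 < evalD p u * ((p : RatFunc ℝ).num).leadingCoeff)) :
    IsProductOfIdempotents (!![p, q; 0, 0] : Matrix (Fin 2) (Fin 2) DressD) := by
  have hpn := (DressD.even_natDegree_num_iff p).2 hpeven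
  have hqn : Odd (q : RatFunc ℝ).num.natDegree := by
    rw [← Nat.not_even_iff_odd, DressD.even_natDegree_num_iff, Int.not_even_iff_odd]
    exact hqodd
  have hp0 : (p : RatFunc ℝ).num ≠ 0 := by
    intro h0
    rcases hroot with ⟨u, -, hu⟩ | ⟨u, -, hu⟩
    · have h := hu (u + 1) (by simp [DressD.evalD_eq_zero_iff, h0])
      simp at h
    · simp [h0] at hu
  set l := (p : RatFunc ℝ).num.leadingCoeff with hl
  have hl0 : l ≠ 0 := leadingCoeff_ne_zero.2 hp0
  have hdp := DressD.denom_eval_ne_zero p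
  have hdq := DressD.denom_eval_ne_zero q
  have hmp := RatFunc.monic_denom (p : RatFunc ℝ)
  have hmq := RatFunc.monic_denom (q : RatFunc ℝ)
  have hdp' := eval_pos_of_monic_of_no_roots hmp hdp
  have hdq' := eval_pos_of_monic_of_no_roots hmq hdq
  have hpos : ∀ u, evalD q u = 0 → 0 < (C l⁻¹ * (p : RatFunc ℝ).num).eval u := by
    intro u hu
    rcases hroot with ⟨v, hv, hvu⟩ | ⟨v, hv, hpv⟩
    · refine eval_pos_of_unique_root (u := v) ?_ ?_ (fun w hw => hvu w ?_) ?_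
      · rw [leadingCoeff_mul, leadingCoeff_C, ← hl, inv_mul_cancel₀ hl0]
        exact one_pos
      · rwa [natDegree_C_mul (inv_ne_zero hl0)]
      · exact (DressD.evalD_eq_zero_iff p w).2 (by simpa [hl0] using hw)
      · rintro rfl
        exact hcomax ⟨u, hv, hu⟩
    · obtain rfl : u = v := by
        have : u ∈ {v | evalD q v = 0} := hu
        rwa [hv] at this
      rw [DressD.evalD_eq] at hpv
      have h₁ : 0 < (p : RatFunc ℝ).num.eval u * l := by
        have := mul_pos hpv (hdp' u)
        rwa [mul_right_comm, div_mul_cancel₀ _ (hdp u)] at this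
      rw [eval_mul, eval_C]
      have := div_pos h₁ (sq_pos_of_ne_zero hl0)
      rwa [show (p : RatFunc ℝ).num.eval u * l / l ^ 2 = l⁻¹ * (p : RatFunc ℝ).num.eval u by
        field_simp] at this
  set F : ℝ[X] := C l⁻¹ * (p : RatFunc ℝ).num * (q : RatFunc ℝ).denom with hF
  set G : ℝ[X] := C l⁻¹ * (q : RatFunc ℝ).num * (p : RatFunc ℝ).denom with hG
  set Γ : ℝ[X] := (p : RatFunc ℝ).denom * (q : RatFunc ℝ).denom with hΓ
  let L : DressD := ⟨_, DressD.algebraMap_C_mem l⟩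
  let L' : DressD := ⟨_, DressD.algebraMap_C_mem l⁻¹⟩
  have hLL : L * L' = 1 := by
    apply Subtype.ext
    simp only [L, L', Subring.coe_mul, ← map_mul]
    simp [hl0]
  have hq0 : (q : RatFunc ℝ).num ≠ 0 := by rintro h; simp [h] at hqn
  have hFd : F.natDegree = (p : RatFunc ℝ).num.natDegree + (q : RatFunc ℝ).denom.natDegree := by
    rw [hF, natDegree_mul (by simp [hl0, hp0]) hmq.ne_zero, natDegree_C_mul (inv_ne_zero hl0)]
  have hGd : G.natDegree = (q : RatFunc ℝ).num.natDegree + (p : RatFunc ℝ).denom.natDegree := by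
    rw [hG, natDegree_mul (by simp [hl0, hq0]) hmp.ne_zero, natDegree_C_mul (inv_ne_zero hl0)]
  have hΓd : Γ.natDegree = (p : RatFunc ℝ).denom.natDegree + (q : RatFunc ℝ).denom.natDegree :=
    hmp.natDegree_mul hmq
  have hep := even_natDegree_of_no_roots hmp hdp
  have heq := even_natDegree_of_no_roots hmq hdq
  have hFe : Even F.natDegree := hFd ▸ hpn.add heq
  have hGo : Odd G.natDegree := hGd ▸ hqn.add_even hep
  have hΓe : Even Γ.natDegree := hΓd ▸ hep.add heq
  have hFΓ : F.natDegree ≤ Γ.natDegree := by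
    have := DressD.natDegree_num_le p
    omega
  have hGΓ : G.natDegree < Γ.natDegree := by
    have := DressD.natDegree_num_le q
    rcases (show G.natDegree ≤ Γ.natDegree by omega).lt_or_eq with h | h
    · exact h
    · exact absurd (h ▸ hΓe) (Nat.not_even_iff_odd.2 hGo)
  have hlc : 0 < F.leadingCoeff := by
    rw [hF, leadingCoeff_mul, leadingCoeff_mul, leadingCoeff_C, hmq.leadingCoeff, ← hl,
      inv_mul_cancel₀ hl0]
    norm_num
  have hΓpos : ∀ u, 0 < Γ.eval u := fun u => by
    rw [hΓ, eval_mul]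
    exact mul_pos (hdp' u) (hdq' u)
  have hFG : ∀ u, G.eval u = 0 → 0 < F.eval u := by
    intro u hu
    rw [hF, eval_mul]
    refine mul_pos (hpos u ?_) (hdq' u)
    rw [DressD.evalD_eq_zero_iff]
    simpa [hG, hl0, hdp u] using hu
  have hp' := RatFunc.algebraMap_ne_zero hmp.ne_zero
  have hq' := RatFunc.algebraMap_ne_zero hmq.ne_zero
  have hP : ((L' * p : DressD) : RatFunc ℝ) =
      algebraMap ℝ[X] (RatFunc ℝ) F / algebraMap ℝ[X] (RatFunc ℝ) Γ := by
    rw [Subring.coe_mul, DressD.eq_num_div_denom p]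
    simp only [L', hF, hΓ, map_mul]
    field_simp
  have hQ : ((L' * q : DressD) : RatFunc ℝ) =
      algebraMap ℝ[X] (RatFunc ℝ) G / algebraMap ℝ[X] (RatFunc ℝ) Γ := by
    rw [Subring.coe_mul, DressD.eq_num_div_denom q]
    simp only [L', hG, hΓ, map_mul]
    field_simp
  have hrow : IsProductOfIdempotents !![L' * p, L' * q; 0, 0] := by
    rcases lt_trichotomy F.natDegree G.natDegree with h | h | h
    · exact DressD.isProductOfIdempotents_row_of_lt_natDegree hΓpos hGΓ hFe hGo h hlc hFG hP hQ
    · exact absurd (h ▸ hFe) (Nat.not_even_iff_odd.2 hGo)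
    · exact DressD.isProductOfIdempotents_row_of_natDegree_lt hΓpos hFΓ hFe h hlc hFG hP hQ
  simpa [← mul_assoc, hLL] using hrow.row_smul L
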